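/- arXiv:2106.03557 — 3 statements merged into one kernel-verified Lean document; each statement's English description precedes it below -/
import Mathlib

section
/- Let A, B, D, E be four pairwise distinct circles in the Euclidean plane that are pairwise not nested and such that any two of them that intersect do so orthogonally. If A intersects B and D intersects E, then the closed line segment joining the centers of A and B is disjoint from the closed line segment joining the centers of D and E. (Equivalently: the straight-line drawing of the intersection graph of a nonnested arrangement of orthogonal circles obtained by placing each vertex at the center of its circle is crossing-free.) -/
open scoped Classical

/-- A circle in the Euclidean plane, given by a center and a positive radius. -/
structure Circ where
  center : EuclideanSpace ℝ (Fin 2)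
  radius : ℝ
  radius_pos : 0 < radius

namespace Circ

/-- The circle as a point set: points at distance exactly `radius` from the center. -/
def points (C : Circ) : Set (EuclideanSpace ℝ (Fin 2)) := Metric.sphere C.center C.radius

/-- The closed disk bounded by the circle. -/
def closedDisk (C : Circ) : Set (EuclideanSpace ℝ (Fin 2)) := Metric.closedBall C.center C.radius

/-- The open disk bounded by the circle. -/
def openDisk (C : Circ) : Set (EuclideanSpace ℝ (Fin 2)) := Metric.ball C.center C.radius

/-- Two circles intersect if they share a point. -/
def Intersects (A B : Circ) : Prop := (A.points ∩ B.points).Nonempty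

/-- Two circles intersect orthogonally. -/
def Orthogonal (A B : Circ) : Prop :=
  Intersects A B ∧ dist A.center B.center ^ 2 = A.radius ^ 2 + B.radius ^ 2

/-- Two circles are nested if the closed disk bounded by one is contained in the
closed disk bounded by the other. -/
def Nested (A B : Circ) : Prop :=
  A.closedDisk ⊆ B.closedDisk ∨ B.closedDisk ⊆ A.closedDisk

end Circ

open Circ

/-- Number of unordered pairs of circles of `𝒜` that intersect. -/
noncomputable def edgeCount (𝒜 : Finset Circ) : ℕ :=
  ((𝒜.powersetCard 2).filter fun e => ∃ A ∈ e, ∃ B ∈ e, A ≠ B ∧ Intersects A B).card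

/-- If the center distance lies between the difference and the sum of the radii,
the two circles intersect. -/
theorem Circ.intersects_of_dist {A B : Circ}
    (h₁ : A.radius < dist A.center B.center + B.radius)
    (h₂ : B.radius < dist A.center B.center + A.radius)
    (h₃ : dist A.center B.center ≤ A.radius + B.radius) : Intersects A B := by
  have ha := A.radius_pos
  by_cases h0 : dist A.center B.center = 0
  · linarith
  have hd : 0 < dist A.center B.center := lt_of_le_of_ne dist_nonneg (Ne.symm h0)
  have hrank : 1 < Module.rank ℝ (EuclideanSpace ℝ (Fin 2)) := by
    rw [← Module.finrank_eq_rank, finrank_euclideanSpace_fin]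
    norm_num
  have hpc := isPreconnected_sphere hrank A.center A.radius
  set d := dist A.center B.center with hd'
  have hmem : ∀ c : ℝ, |c| = 1 →
      AffineMap.lineMap A.center B.center (c * (A.radius / d)) ∈
        Metric.sphere A.center A.radius := by
    intro c hc
    rw [Metric.mem_sphere, dist_lineMap_left, Real.norm_eq_abs, abs_mul, hc, one_mul,
      abs_of_pos (by positivity)]
    field_simp
    exact hd'.symm
  have hdist : ∀ c : ℝ,
      dist (AffineMap.lineMap A.center B.center (c * (A.radius / d))) B.center =
        |d - c * A.radius| := by
    intro c
    rw [dist_lineMap_right, Real.norm_eq_abs, ← hd', ← abs_of_pos hd, ← abs_mul, abs_of_pos hd]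
    congr 1
    field_simp
  obtain ⟨p, hp, hpB⟩ := hpc.intermediate_value (hmem 1 (by simp)) (hmem (-1) (by simp))
    (f := fun x => dist x B.center) (by fun_prop)
    (show B.radius ∈ _ by
      rw [hdist, hdist]
      constructor
      · rw [abs_le]; constructor <;> linarith
      · refine le_trans ?_ (le_abs_self _); linarith)
  exact ⟨p, hp, hpB⟩

/-- Two circles that are not nested, and are orthogonal if they intersect, have centers at
squared distance at least the sum of the squared radii. -/
theorem Circ.sq_radius_add_sq_radius_le {A B : Circ} (hn : ¬ Nested A B)
    (ho : Intersects A B → Orthogonal A B) :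
    A.radius ^ 2 + B.radius ^ 2 ≤ dist A.center B.center ^ 2 := by
  have ha := A.radius_pos
  have hb := B.radius_pos
  by_cases h₃ : dist A.center B.center ≤ A.radius + B.radius
  · refine (ho (intersects_of_dist ?_ ?_ h₃)).2.ge
    · by_contra! h
      refine hn (Or.inr (Metric.closedBall_subset_closedBall' ?_))
      rw [dist_comm]
      linarith
    · by_contra! h
      exact hn (Or.inl (Metric.closedBall_subset_closedBall' (by linarith)))
  · nlinarith

/-- The segment joining the centers of two orthogonal circles avoids the open disk of every
circle far enough from both. -/
theorem Circ.radius_le_dist_of_mem_segment {A B X : Circ}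
    (hAB : dist A.center B.center ^ 2 = A.radius ^ 2 + B.radius ^ 2)
    (hA : A.radius ^ 2 + X.radius ^ 2 ≤ dist A.center X.center ^ 2)
    (hB : B.radius ^ 2 + X.radius ^ 2 ≤ dist B.center X.center ^ 2)
    {p : EuclideanSpace ℝ (Fin 2)} (hp : p ∈ segment ℝ A.center B.center) :
    X.radius ≤ dist p X.center := by
  obtain ⟨s, t, hs, ht, hst, rfl⟩ := hp
  obtain rfl : s = 1 - t := by linarith
  refine le_of_sq_le_sq ?_ dist_nonneg
  simp only [EuclideanSpace.dist_sq_eq, Fin.sum_univ_two, Real.dist_eq, sq_abs, PiLp.add_apply,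
    PiLp.smul_apply, smul_eq_mul] at *
  nlinarith [mul_le_mul_of_nonneg_left hA hs, mul_le_mul_of_nonneg_left hB ht,
    sq_nonneg ((1 - t) * A.radius), sq_nonneg (t * B.radius), congrArg (fun z => t * (1 - t) * z) hAB]

theorem stmt3 (A B D E : Circ)
    (hAB : A ≠ B) (hAD : A ≠ D) (hAE : A ≠ E) (hBD : B ≠ D) (hBE : B ≠ E) (hDE : D ≠ E)
    (hnn : ({A, B, D, E} : Set Circ).Pairwise fun X Y => ¬ Nested X Y)
    (ho : ({A, B, D, E} : Set Circ).Pairwise fun X Y => Intersects X Y → Orthogonal X Y)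
    (hintAB : Intersects A B) (hintDE : Intersects D E) :
    Disjoint (segment ℝ A.center B.center) (segment ℝ D.center E.center) := by
  have far : ∀ X ∈ ({A, B, D, E} : Set Circ), ∀ Y ∈ ({A, B, D, E} : Set Circ), X ≠ Y →
      X.radius ^ 2 + Y.radius ^ 2 ≤ dist X.center Y.center ^ 2 := fun X hX Y hY h =>
    sq_radius_add_sq_radius_le (hnn hX hY h) (ho hX hY h)
  have hABo := (ho (by simp) (by simp) hAB hintAB).2
  have hDEo := (ho (by simp) (by simp) hDE hintDE).2
  rw [Set.disjoint_left]
  intro p hp hq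
  have hD := radius_le_dist_of_mem_segment hABo (far A (by simp) D (by simp) hAD)
    (far B (by simp) D (by simp) hBD) hp
  have hE := radius_le_dist_of_mem_segment hABo (far A (by simp) E (by simp) hAE)
    (far B (by simp) E (by simp) hBE) hp
  have hadd := dist_add_dist_of_mem_segment hq
  rw [dist_comm] at hD
  nlinarith [D.radius_pos, E.radius_pos, mul_pos D.radius_pos E.radius_pos]
end

section
/- Let 𝒜 be an arrangement of orthogonal circles and let A, B ∈ 𝒜 be two nested circles. Then at most two circles of 𝒜 intersect both A and B. -/
open scoped Classical

open Circ

namespace Circ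

theorem dist_sq_eq (p q : EuclideanSpace ℝ (Fin 2)) :
    dist p q ^ 2 = (p 0 - q 0) ^ 2 + (p 1 - q 1) ^ 2 := by
  rw [EuclideanSpace.dist_eq, Real.sq_sqrt (by positivity)]
  simp [Fin.sum_univ_two, Real.dist_eq, sq_abs]

theorem mem_points_iff (C : Circ) (p : EuclideanSpace ℝ (Fin 2)) :
    p ∈ C.points ↔ (p 0 - C.center 0) ^ 2 + (p 1 - C.center 1) ^ 2 = C.radius ^ 2 := by
  rw [← dist_sq_eq, points, Metric.mem_sphere, sq_eq_sq₀ dist_nonneg C.radius_pos.le]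

theorem ext_of_center_radius {C D : Circ} (h₀ : C.center 0 = D.center 0)
    (h₁ : C.center 1 = D.center 1) (hr : C.radius = D.radius) : C = D := by
  have hc : C.center = D.center := by
    ext i
    fin_cases i
    · exact h₀
    · exact h₁
  cases C
  cases D
  simp_all

/-- If the disk of `A` lies in that of `B`, the centers differ and the circles do not intersect,
then the center distance plus the inner radius is less than the outer radius. -/
theorem dist_add_radius_lt {A B : Circ} (hsub : A.closedDisk ⊆ B.closedDisk)
    (hd : 0 < dist A.center B.center) (hAB : ¬ Intersects A B) :
    dist A.center B.center + A.radius < B.radius := by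
  set d := dist A.center B.center with hd_def
  set p : EuclideanSpace ℝ (Fin 2) :=
    A.center + (A.radius / d) • (A.center - B.center) with hp
  have hnorm : ‖A.center - B.center‖ = d := (dist_eq_norm _ _).symm
  have ha := A.radius_pos
  have hpA : dist p A.center = A.radius := by
    rw [dist_eq_norm, hp, add_sub_cancel_left, norm_smul, hnorm, Real.norm_of_nonneg (by positivity)]
    field_simp
  have hpB : dist p B.center = d + A.radius := by
    have h : p - B.center = (1 + A.radius / d) • (A.center - B.center) := by
      rw [hp, add_smul, one_smul]
      abel
    rw [dist_eq_norm, h, norm_smul, hnorm, Real.norm_of_nonneg (by positivity)]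
    field_simp
  have hle : d + A.radius ≤ B.radius := by
    rw [← hpB]
    exact hsub (Metric.mem_closedBall.2 hpA.le)
  refine hle.lt_of_ne fun h => hAB ⟨p, hpA, ?_⟩
  exact hpB.trans h

/-- Nested distinct circles that may only intersect orthogonally do not intersect. -/
theorem not_intersects_of_subset {A B : Circ} (hsub : A.closedDisk ⊆ B.closedDisk)
    (ho : Intersects A B → Orthogonal A B) : ¬ Intersects A B := by
  intro hI
  have hd := (ho hI).2
  have hmem : dist A.center B.center ≤ B.radius :=
    hsub (Metric.mem_closedBall_self A.radius_pos.le)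
  nlinarith [A.radius_pos, B.radius_pos, dist_nonneg (x := A.center) (y := B.center)]

/-- Three circles orthogonal to two nested circles cannot pairwise be disjoint or orthogonal. -/
theorem false_of_three_orthogonal {A B : Circ} {D : Fin 3 → Circ} (hne : A ≠ B)
    (hsub : A.closedDisk ⊆ B.closedDisk) (hAB : Intersects A B → Orthogonal A B)
    (hA : ∀ i, Orthogonal (D i) A) (hB : ∀ i, Orthogonal (D i) B)
    (hD : ∀ i j, i ≠ j → Intersects (D i) (D j) → Orthogonal (D i) (D j)) : False := by
  have hI := not_intersects_of_subset hsub hAB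
  have hA' := fun i => (dist_sq_eq _ _).symm.trans (hA i).2
  have hB' := fun i => (dist_sq_eq _ _).symm.trans (hB i).2
  have ha := A.radius_pos
  have hb := B.radius_pos
  have hd : 0 < dist A.center B.center := by
    refine dist_pos.2 fun hc => hne ?_
    have h₁ := hA' 0
    have h₂ := hB' 0
    rw [← hc] at h₂
    refine ext_of_center_radius (by rw [hc]) (by rw [hc]) ?_
    exact (sq_eq_sq₀ ha.le hb.le).1 (by linarith)
  have hlt := dist_add_radius_lt hsub hd hI
  have hd2 := dist_sq_eq A.center B.center
  set d := dist A.center B.center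
  obtain ⟨v₀, hv₀⟩ : ∃ x, x = B.center 0 - A.center 0 := ⟨_, rfl⟩
  obtain ⟨v₁, hv₁⟩ : ∃ x, x = B.center 1 - A.center 1 := ⟨_, rfl⟩
  have hvd : v₀ ^ 2 + v₁ ^ 2 = d ^ 2 := by rw [hd2, hv₀, hv₁]; ring
  obtain ⟨m, hm⟩ : ∃ x, x = (d ^ 2 + A.radius ^ 2 - B.radius ^ 2) / 2 := ⟨_, rfl⟩
  obtain ⟨K, hK⟩ : ∃ x, x = m ^ 2 - d ^ 2 * A.radius ^ 2 := ⟨_, rfl⟩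
  have hKpos : 0 < K := by
    have h : K = (B.radius - (d - A.radius)) * (B.radius + (d - A.radius)) *
        ((B.radius - (d + A.radius)) * (B.radius + (d + A.radius))) / 4 := by
      rw [hK, hm]; ring
    have h₁ : 0 < B.radius - (d - A.radius) := by linarith
    have h₂ : 0 < B.radius + (d - A.radius) := by linarith
    have h₃ : 0 < B.radius - (d + A.radius) := by linarith
    rw [h]
    positivity
  obtain ⟨w, hw⟩ : ∃ w : Fin 3 → ℝ, ∀ i, w i =
      v₀ * ((D i).center 1 - A.center 1) - v₁ * ((D i).center 0 - A.center 0) :=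
    ⟨_, fun _ => rfl⟩
  have hdot : ∀ i, v₀ * ((D i).center 0 - A.center 0) + v₁ * ((D i).center 1 - A.center 1) = m := by
    intro i
    have h₁ := hA' i
    have h₂ := hB' i
    rw [hm, ← hvd, hv₀, hv₁]
    linarith
  have hrad : ∀ i, d ^ 2 * (D i).radius ^ 2 = w i ^ 2 + K := by
    intro i
    rw [hK, ← hdot i, hw i, ← hvd]
    linear_combination (-(v₀ ^ 2 + v₁ ^ 2)) * hA' i
  -- All circles orthogonal to both `A` and `B` pass through a common point on the line of centers.
  have hcommon : ∀ i j, Intersects (D i) (D j) := by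
    intro i j
    have hs : √K ^ 2 = K := Real.sq_sqrt hKpos.le
    obtain ⟨t, ht⟩ : ∃ x, x = (m + √K) / d ^ 2 := ⟨_, rfl⟩
    have ht' : t * d ^ 2 = m + √K := by rw [ht]; field_simp
    have key : ∀ k, !₂[A.center 0 + t * v₀, A.center 1 + t * v₁] ∈ (D k).points := by
      intro k
      rw [mem_points_iff]
      simp only [Matrix.cons_val_zero, Matrix.cons_val_one]
      have h : d ^ 2 * (t ^ 2 * d ^ 2 - 2 * t * m + A.radius ^ 2) = 0 := by
        linear_combination (t * d ^ 2 + √K - m) * ht' + hs + hK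
      have h' : t ^ 2 * d ^ 2 - 2 * t * m + A.radius ^ 2 = 0 :=
        (mul_eq_zero.1 h).resolve_left (by positivity)
      linear_combination h' + hA' k + t ^ 2 * hvd - 2 * t * hdot k
    exact ⟨_, key i, key j⟩
  have hprod : ∀ i j, i ≠ j → w i * w j = -K := by
    intro i j hij
    have h := (dist_sq_eq _ _).symm.trans (hD i j hij (hcommon i j)).2
    have hwij : (w i - w j) ^ 2 = d ^ 2 * ((D i).radius ^ 2 + (D j).radius ^ 2) := by
      have h₀ : v₀ * ((D i).center 0 - (D j).center 0) +
          v₁ * ((D i).center 1 - (D j).center 1) = 0 := by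
        linear_combination hdot i - hdot j
      rw [← h, ← hvd, hw i, hw j]
      linear_combination (-(v₀ * ((D i).center 0 - (D j).center 0) +
          v₁ * ((D i).center 1 - (D j).center 1))) * h₀
    linarith [hrad i, hrad j]
  have h₀₁ := hprod 0 1 (by decide)
  have h₀₂ := hprod 0 2 (by decide)
  have h₁₂ := hprod 1 2 (by decide)
  have h : (w 0 * w 1 * w 2) ^ 2 = -K ^ 3 := by
    calc (w 0 * w 1 * w 2) ^ 2 = (w 0 * w 1) * (w 0 * w 2) * (w 1 * w 2) := by ring
      _ = -K ^ 3 := by rw [h₀₁, h₀₂, h₁₂]; ring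
  nlinarith [sq_nonneg (w 0 * w 1 * w 2), pow_pos hKpos 3]

theorem card_filter_le_two_of_subset (𝒜 : Finset Circ)
    (ho : (𝒜 : Set Circ).Pairwise fun X Y => Intersects X Y → Orthogonal X Y)
    {A B : Circ} (hA : A ∈ 𝒜) (hB : B ∈ 𝒜) (hAB : A ≠ B) (hsub : A.closedDisk ⊆ B.closedDisk) :
    (𝒜.filter fun D => D ≠ A ∧ D ≠ B ∧ Intersects D A ∧ Intersects D B).card ≤ 2 := by
  by_contra! hcard
  obtain ⟨X, hX, Y, hY, Z, hZ, hXY, hXZ, hYZ⟩ := Finset.two_lt_card.1 hcard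
  rw [Finset.mem_filter] at hX hY hZ
  have hmem : ∀ i, ![X, Y, Z] i ∈ 𝒜 ∧ ![X, Y, Z] i ≠ A ∧ ![X, Y, Z] i ≠ B ∧
      Intersects (![X, Y, Z] i) A ∧ Intersects (![X, Y, Z] i) B := by
    intro i
    fin_cases i
    exacts [hX, hY, hZ]
  have hinj : ∀ i j, i ≠ j → ![X, Y, Z] i ≠ ![X, Y, Z] j := by
    intro i j hij
    fin_cases i <;> fin_cases j <;> simp_all [eq_comm]
  refine false_of_three_orthogonal (D := ![X, Y, Z]) hAB hsub (ho hA hB hAB) ?_ ?_ ?_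
  · exact fun i => ho (hmem i).1 hA (hmem i).2.1 (hmem i).2.2.2.1
  · exact fun i => ho (hmem i).1 hB (hmem i).2.2.1 (hmem i).2.2.2.2
  · exact fun i j hij => ho (hmem i).1 (hmem j).1 (hinj i j hij)

end Circ

theorem stmt5 (𝒜 : Finset Circ)
    (ho : (𝒜 : Set Circ).Pairwise fun X Y => Intersects X Y → Orthogonal X Y)
    (A B : Circ) (hA : A ∈ 𝒜) (hB : B ∈ 𝒜) (hAB : A ≠ B) (hnest : Nested A B) :
    (𝒜.filter fun D => D ≠ A ∧ D ≠ B ∧ Intersects D A ∧ Intersects D B).card ≤ 2 := by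
  rcases hnest with h | h
  · exact card_filter_le_two_of_subset 𝒜 ho hA hB hAB h
  · refine le_of_eq_of_le ?_ (card_filter_le_two_of_subset 𝒜 ho hB hA hAB.symm h)
    congr 1
    ext D
    simp only [Finset.mem_filter]
    tauto
end

section
/- In every finite nonempty arrangement of orthogonal circles 𝒜 there exists a nonempty subset S ⊆ 𝒜 such that the number of unordered pairs {A, B} of intersecting circles of 𝒜 with at least one of A, B belonging to S is at most 4·|S| + 5. -/
open scoped Classical

open Circ

/-- Number of unordered pairs of intersecting circles of `𝒜` with at least one member in `S`. -/
noncomputable def incCount (𝒜 S : Finset Circ) : ℕ :=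
  ((𝒜.powersetCard 2).filter fun e =>
    (∃ A ∈ e, ∃ B ∈ e, A ≠ B ∧ Intersects A B) ∧ ∃ A ∈ e, A ∈ S).card

/-- Nonzero plane vectors making pairwise angles of at least `π / 3` number at most six. -/
lemma card_le_six_of_pairwise_inner_le {ι : Type*} (s : Finset ι) (z : ι → ℂ)
    (hz : ∀ i ∈ s, z i ≠ 0)
    (hs : ∀ i ∈ s, ∀ j ∈ s, i ≠ j →
      2 * ((z i).re * (z j).re + (z i).im * (z j).im) ≤ ‖z i‖ * ‖z j‖) :
    s.card ≤ 6 := by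
  have hπ := Real.pi_pos
  have hmaps : Set.MapsTo (fun i => ⌈(z i).arg * (3 / Real.pi)⌉) (s : Set ι)
      (Finset.Icc (-2 : ℤ) 3 : Finset ℤ) := by
    intro i _
    have h1 := Complex.neg_pi_lt_arg (z i)
    have h2 := Complex.arg_le_pi (z i)
    have h3 : (-3 : ℝ) < (z i).arg * (3 / Real.pi) := by
      rw [mul_div_assoc', lt_div_iff₀ hπ]; linarith
    have h4 : (z i).arg * (3 / Real.pi) ≤ 3 := by
      rw [mul_div_assoc', div_le_iff₀ hπ]; linarith
    have h5 : (-3 : ℤ) < ⌈(z i).arg * (3 / Real.pi)⌉ := by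
      rw [Int.lt_ceil]; exact_mod_cast h3
    have h6 : ⌈(z i).arg * (3 / Real.pi)⌉ ≤ (3 : ℤ) := by
      rw [Int.ceil_le]; exact_mod_cast h4
    simp only [Finset.coe_Icc, Set.mem_Icc]
    omega
  have hinj : Set.InjOn (fun i => ⌈(z i).arg * (3 / Real.pi)⌉) (s : Set ι) := by
    intro i hi j hj hij
    by_contra hne
    have hlt : |(z i).arg - (z j).arg| < Real.pi / 3 := by
      have h1 := Int.le_ceil ((z i).arg * (3 / Real.pi))
      have h2 := Int.ceil_lt_add_one ((z i).arg * (3 / Real.pi))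
      have h3 := Int.le_ceil ((z j).arg * (3 / Real.pi))
      have h4 := Int.ceil_lt_add_one ((z j).arg * (3 / Real.pi))
      simp only at hij
      rw [hij] at h1 h2
      have h5 : |((z i).arg - (z j).arg) * (3 / Real.pi)| < 1 := by
        rw [abs_lt]; constructor <;> linarith
      rw [abs_mul, abs_of_pos (by positivity : 0 < 3 / Real.pi), mul_div_assoc',
        div_lt_one hπ] at h5
      linarith
    have hcos : 1 / 2 < Real.cos ((z i).arg - (z j).arg) := by
      rw [← Real.cos_abs, ← Real.cos_pi_div_three]
      exact Real.cos_lt_cos_of_nonneg_of_le_pi (abs_nonneg _) (by linarith) hlt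
    have hpos : 0 < ‖z i‖ * ‖z j‖ :=
      mul_pos (norm_pos_iff.2 (hz i hi)) (norm_pos_iff.2 (hz j hj))
    have hinner : (z i).re * (z j).re + (z i).im * (z j).im =
        ‖z i‖ * ‖z j‖ * Real.cos ((z i).arg - (z j).arg) := by
      rw [Real.cos_sub, ← Complex.norm_mul_cos_arg (z i), ← Complex.norm_mul_cos_arg (z j),
        ← Complex.norm_mul_sin_arg (z i), ← Complex.norm_mul_sin_arg (z j)]
      ring
    have := hs i hi j hj hne
    rw [hinner] at this
    nlinarith
  simpa using Finset.card_le_card_of_injOn _ hmaps hinj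

namespace Circ

lemma dist_center_sq (A B : Circ) :
    dist A.center B.center ^ 2 =
      (A.center 0 - B.center 0) ^ 2 + (A.center 1 - B.center 1) ^ 2 := by
  rw [EuclideanSpace.dist_eq, Real.sq_sqrt (by positivity), Fin.sum_univ_two,
    Real.dist_eq, Real.dist_eq, sq_abs, sq_abs]

lemma intersects_comm {A B : Circ} : Intersects A B ↔ Intersects B A := by
  unfold Intersects; rw [Set.inter_comm]

/-- Circles in the plane meet as soon as the triangle inequalities allow it. -/
lemma intersects_of_dist_s10 {A B : Circ} (h₁ : |A.radius - B.radius| ≤ dist A.center B.center)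
    (h₂ : dist A.center B.center ≤ A.radius + B.radius) : Intersects A B := by
  have hrA := A.radius_pos
  have hrB := B.radius_pos
  rcases (dist_nonneg (x := A.center) (y := B.center)).eq_or_lt with hd | hd
  · have hc : A.center = B.center := dist_eq_zero.1 hd.symm
    have hr : A.radius = B.radius := by
      rw [← hd] at h₁; exact sub_eq_zero.1 (abs_nonpos_iff.1 h₁)
    obtain ⟨x, hx⟩ := NormedSpace.sphere_nonempty (x := A.center) |>.2 hrA.le
    exact ⟨x, hx, by rw [points, ← hc, ← hr]; exact hx⟩
  · set d := dist A.center B.center with hd_def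
    have hsq := dist_center_sq A B
    rw [← hd_def] at hsq
    set u := B.center 0 - A.center 0 with hu
    set v := B.center 1 - A.center 1 with hv
    have huv : u ^ 2 + v ^ 2 = d ^ 2 := by rw [hsq]; ring
    set p := (d ^ 2 + A.radius ^ 2 - B.radius ^ 2) / (2 * d ^ 2) with hp
    have hpd : 2 * p * d ^ 2 = d ^ 2 + A.radius ^ 2 - B.radius ^ 2 := by
      rw [hp]; field_simp
    have hnn : 0 ≤ A.radius ^ 2 / d ^ 2 - p ^ 2 := by
      rw [sub_nonneg, le_div_iff₀ (by positivity)]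
      have habs := abs_le.1 h₁
      have h3 : 0 ≤ (B.radius ^ 2 - (d - A.radius) ^ 2) * ((d + A.radius) ^ 2 - B.radius ^ 2) := by
        apply mul_nonneg <;> nlinarith
      have h4 : (2 * p * d ^ 2) ^ 2 ≤ 4 * d ^ 2 * A.radius ^ 2 := by rw [hpd]; nlinarith
      have h5 : 0 < d ^ 2 := by positivity
      nlinarith
    set q := √(A.radius ^ 2 / d ^ 2 - p ^ 2) with hq
    have hq2 : (p ^ 2 + q ^ 2) * d ^ 2 = A.radius ^ 2 := by
      rw [hq, Real.sq_sqrt hnn]; field_simp; ring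
    refine ⟨!₂[A.center 0 + p * u - q * v, A.center 1 + p * v + q * u], ?_, ?_⟩
    · rw [points, Metric.mem_sphere, EuclideanSpace.dist_eq, Fin.sum_univ_two, Real.dist_eq,
        Real.dist_eq, sq_abs, sq_abs, Real.sqrt_eq_iff_eq_sq (by positivity) hrA.le]
      simp only [Matrix.cons_val_zero, Matrix.cons_val_one]
      rw [← hq2, ← huv]; ring
    · rw [points, Metric.mem_sphere, EuclideanSpace.dist_eq, Fin.sum_univ_two, Real.dist_eq,
        Real.dist_eq, sq_abs, sq_abs, Real.sqrt_eq_iff_eq_sq (by positivity) hrB.le]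
      simp only [Matrix.cons_val_zero, Matrix.cons_val_one]
      have h0 : B.center 0 = A.center 0 + u := by rw [hu]; ring
      have h1 : B.center 1 = A.center 1 + v := by rw [hv]; ring
      rw [h0, h1]
      have : B.radius ^ 2 = (p ^ 2 + q ^ 2 + 1 - 2 * p) * (u ^ 2 + v ^ 2) := by
        rw [huv]; linarith
      rw [this]; ring

/-- `A.Inside B` means that `A` lies in the open disk bounded by `B`. -/
def Inside (A B : Circ) : Prop := dist A.center B.center + A.radius < B.radius

lemma Inside.radius_lt {A B : Circ} (h : A.Inside B) : A.radius < B.radius := by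
  have := dist_nonneg (x := A.center) (y := B.center)
  unfold Inside at h
  linarith

lemma Inside.trans {A B C : Circ} (h₁ : A.Inside B) (h₂ : B.Inside C) : A.Inside C := by
  have := dist_triangle A.center B.center C.center
  unfold Inside at *
  linarith

lemma intersects_or_separated (A B : Circ) :
    Intersects A B ∨ A.radius + B.radius < dist A.center B.center ∨ A.Inside B ∨ B.Inside A := by
  by_contra! h
  obtain ⟨h₀, h₁, h₂, h₃⟩ := h
  unfold Inside at h₂ h₃
  rw [dist_comm] at h₃
  exact h₀ (intersects_of_dist_s10 (abs_le.2 ⟨by linarith, by linarith⟩) h₁)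

lemma Orthogonal.dist_lt {A B : Circ} (h : Orthogonal A B) :
    dist A.center B.center < A.radius + B.radius := by
  have := h.2
  have hA := A.radius_pos
  have hB := B.radius_pos
  nlinarith

lemma Orthogonal.not_inside {A B : Circ} (h : Orthogonal A B) : ¬ A.Inside B := by
  intro hi
  have := h.2
  have hA := A.radius_pos
  have hd := dist_nonneg (x := A.center) (y := B.center)
  unfold Inside at hi
  nlinarith

lemma Orthogonal.symm {A B : Circ} (h : Orthogonal A B) : Orthogonal B A :=
  ⟨intersects_comm.1 h.1, by rw [dist_comm, h.2, add_comm]⟩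

/-- The position of the center of `C` along the radical axis of `A` and `B`, up to scaling. -/
noncomputable def axisCoord (A B C : Circ) : ℝ :=
  (A.center 0 - B.center 0) * (C.center 1 - B.center 1) -
    (A.center 1 - B.center 1) * (C.center 0 - B.center 0)

/-- Two circles orthogonal to two nested circles intersect, and if they are orthogonal, their
centers lie on different sides of the line of centers. -/
lemma Inside.common_orthogonal {A B C D : Circ} (h : B.Inside A)
    (hCA : Orthogonal C A) (hCB : Orthogonal C B) (hDA : Orthogonal D A) (hDB : Orthogonal D B) :
    Intersects C D ∧ (Orthogonal C D → axisCoord A B C * axisCoord A B D < 0) := by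
  have eCA := hCA.2
  have eCB := hCB.2
  have eDA := hDA.2
  have eDB := hDB.2
  have hdist := dist_center_sq A B
  have hCD := dist_center_sq C D
  rw [dist_center_sq] at eCA eCB eDA eDB
  have hrA := A.radius_pos
  have hrB := B.radius_pos
  have hrC := C.radius_pos
  have hrD := D.radius_pos
  have hlt : dist A.center B.center + B.radius < A.radius := by
    rw [dist_comm]; exact h
  have hδ0 := dist_nonneg (x := A.center) (y := B.center)
  have hd0 := dist_nonneg (x := C.center) (y := D.center)
  unfold axisCoord
  unfold Orthogonal
  have hint := @intersects_of_dist_s10 C D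
  generalize hδ : dist A.center B.center = δ at *
  generalize hd : dist C.center D.center = d at *
  generalize A.radius = a at *
  generalize B.radius = b at *
  generalize C.radius = r at *
  generalize D.radius = s at *
  obtain ⟨x, hx⟩ : ∃ x, x = A.center 0 - B.center 0 := ⟨_, rfl⟩
  obtain ⟨y, hy⟩ : ∃ y, y = A.center 1 - B.center 1 := ⟨_, rfl⟩
  obtain ⟨u, hu⟩ : ∃ x, x = C.center 0 - B.center 0 := ⟨_, rfl⟩
  obtain ⟨v, hv⟩ : ∃ y, y = C.center 1 - B.center 1 := ⟨_, rfl⟩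
  obtain ⟨p, hp⟩ : ∃ x, x = D.center 0 - B.center 0 := ⟨_, rfl⟩
  obtain ⟨q, hq⟩ : ∃ y, y = D.center 1 - B.center 1 := ⟨_, rfl⟩
  rw [show C.center 0 - A.center 0 = u - x by rw [hu, hx]; ring,
    show C.center 1 - A.center 1 = v - y by rw [hv, hy]; ring] at eCA
  rw [show D.center 0 - A.center 0 = p - x by rw [hp, hx]; ring,
    show D.center 1 - A.center 1 = q - y by rw [hq, hy]; ring] at eDA
  rw [show C.center 0 - D.center 0 = u - p by rw [hu, hp]; ring,
    show C.center 1 - D.center 1 = v - q by rw [hv, hq]; ring] at hCD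
  rw [← hx, ← hy] at hdist
  rw [← hu, ← hv] at eCB
  rw [← hp, ← hq] at eDB
  rw [← hx, ← hy, ← hu, ← hv, ← hp, ← hq]
  clear hx hy hu hv hp hq
  obtain ⟨k, hk⟩ : ∃ k, k = (δ ^ 2 - a ^ 2 + b ^ 2) / 2 := ⟨_, rfl⟩
  have hC : x * u + y * v = k := by linear_combination (eCB - eCA - hdist) / 2 - hk
  have hD : x * p + y * q = k := by linear_combination (eDB - eDA - hdist) / 2 - hk
  obtain ⟨t, ht⟩ : ∃ t, t = x * v - y * u := ⟨_, rfl⟩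
  obtain ⟨w, hw⟩ : ∃ t, t = x * q - y * p := ⟨_, rfl⟩
  rw [← ht, ← hw]
  have hkneg : k < -(b * δ) := by
    have : (δ + b) ^ 2 < a ^ 2 := pow_lt_pow_left₀ hlt (by positivity) two_ne_zero
    linarith
  have hδ : 0 < δ := by
    rcases hδ0.eq_or_lt with h0 | h0
    · rw [← h0] at hdist hk
      have hx0 : x = 0 := pow_eq_zero_iff two_ne_zero |>.1
        (by linarith [sq_nonneg x, sq_nonneg y])
      have hy0 : y = 0 := pow_eq_zero_iff two_ne_zero |>.1
        (by linarith [sq_nonneg x, sq_nonneg y])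
      rw [hx0, hy0, zero_mul, zero_mul, add_zero] at hC
      rw [← hC, ← h0, mul_zero, neg_zero] at hkneg
      exact absurd hkneg (lt_irrefl 0)
    · exact h0
  obtain ⟨m, hm⟩ : ∃ m, m = k ^ 2 - b ^ 2 * δ ^ 2 := ⟨_, rfl⟩
  have hm0 : 0 < m := by nlinarith [mul_pos hrB hδ]
  have hr : δ ^ 2 * r ^ 2 = m + t ^ 2 := by
    rw [show r ^ 2 = u ^ 2 + v ^ 2 - b ^ 2 by linarith, hm, ht, ← hC, hdist]; ring
  have hs : δ ^ 2 * s ^ 2 = m + w ^ 2 := by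
    rw [show s ^ 2 = p ^ 2 + q ^ 2 - b ^ 2 by linarith, hm, hw, ← hD, hdist]; ring
  have hdd : δ ^ 2 * d ^ 2 = (t - w) ^ 2 := by
    have : x * (u - p) + y * (v - q) = 0 := by linarith
    rw [hdist, hCD, ht, hw]
    linear_combination (x * (u - p) + y * (v - q)) * this
  have hδ2 : 0 < δ ^ 2 := by positivity
  have hcs : |m + t * w| ≤ δ ^ 2 * (r * s) := by
    apply abs_le_of_sq_le_sq _ (by positivity)
    have : (δ ^ 2 * (r * s)) ^ 2 = (m + t ^ 2) * (m + w ^ 2) := by rw [← hr, ← hs]; ring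
    rw [this]
    nlinarith [mul_nonneg hm0.le (sq_nonneg (t - w))]
  obtain ⟨hc1, hc2⟩ := abs_le.1 hcs
  refine ⟨hint ?_ ?_, fun ho => ?_⟩
  · apply abs_le_of_sq_le_sq _ hd0
    refine le_of_mul_le_mul_left ?_ hδ2
    rw [hdd]
    linarith
  · apply le_of_sq_le_sq _ (by positivity)
    refine le_of_mul_le_mul_left ?_ hδ2
    rw [hdd]
    linarith
  · have h2 := ho.2
    have : δ ^ 2 * d ^ 2 = δ ^ 2 * r ^ 2 + δ ^ 2 * s ^ 2 := by rw [h2]; ring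
    rw [hdd, hr, hs] at this
    linarith

/-- At most two circles of an orthogonal arrangement are orthogonal to two nested circles. -/
lemma Inside.card_common_orthogonal_le {A B : Circ} (h : B.Inside A) (N : Finset Circ)
    (ho : (N : Set Circ).Pairwise fun X Y => Intersects X Y → Orthogonal X Y)
    (hA : ∀ C ∈ N, Orthogonal C A) (hB : ∀ C ∈ N, Orthogonal C B) : N.card ≤ 2 := by
  by_contra! hN
  obtain ⟨C, D, E, hC, hD, hE, hCD, hCE, hDE⟩ := Finset.two_lt_card_iff.1 hN
  have key : ∀ X ∈ N, ∀ Y ∈ N, X ≠ Y → axisCoord A B X * axisCoord A B Y < 0 := by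
    intro X hX Y hY hXY
    obtain ⟨h₁, h₂⟩ := h.common_orthogonal (hA X hX) (hB X hX) (hA Y hY) (hB Y hY)
    exact h₂ (ho hX hY hXY h₁)
  have h₁ := key C hC D hD hCD
  have h₂ := key C hC E hE hCE
  have h₃ := key D hD E hE hDE
  nlinarith [mul_pos_of_neg_of_neg h₁ h₂, sq_nonneg (axisCoord A B C)]

/-- A circle is orthogonal to at most six circles of an orthogonal arrangement that are pairwise
not nested and at least as large. -/
lemma card_le_six_of_not_inside (B : Circ) (N : Finset Circ)
    (ho : (N : Set Circ).Pairwise fun X Y => Intersects X Y → Orthogonal X Y)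
    (hB : ∀ C ∈ N, Orthogonal C B) (hr : ∀ C ∈ N, B.radius ≤ C.radius)
    (hN : ∀ C ∈ N, ∀ D ∈ N, ¬ C.Inside D) : N.card ≤ 6 := by
  have hb := B.radius_pos
  let z : Circ → ℂ := fun C => ⟨C.center 0 - B.center 0, C.center 1 - B.center 1⟩
  have hz : ∀ C, ‖z C‖ = dist C.center B.center := by
    intro C
    rw [Complex.norm_eq_sqrt_sq_add_sq, Real.sqrt_eq_iff_eq_sq (by positivity) dist_nonneg,
      dist_center_sq]
  have hlow : ∀ C ∈ N, 2 * B.radius ^ 2 ≤ ‖z C‖ ^ 2 := by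
    intro C hC
    rw [hz, (hB C hC).2]
    nlinarith [hr C hC]
  refine card_le_six_of_pairwise_inner_le N z (fun C hC h0 => ?_) (fun C hC D hD hCD => ?_)
  · have := hlow C hC
    rw [h0, norm_zero] at this
    nlinarith
  · have hdist : C.radius ^ 2 + D.radius ^ 2 ≤ dist C.center D.center ^ 2 := by
      have hrC := C.radius_pos
      have hrD := D.radius_pos
      rcases intersects_or_separated C D with h | h | h | h
      · exact (ho hC hD hCD h).2.ge
      · nlinarith
      · exact absurd h (hN C hC D hD)
      · exact absurd h (hN D hD C hC)
    have hC2 := (hB C hC).2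
    have hD2 := (hB D hD).2
    rw [dist_center_sq] at hdist hC2 hD2
    have hin : (z C).re * (z D).re + (z C).im * (z D).im ≤ B.radius ^ 2 := by
      simp only [z]; nlinarith
    have hprod : 2 * B.radius ^ 2 ≤ ‖z C‖ * ‖z D‖ := by
      apply le_of_sq_le_sq _ (by positivity)
      rw [mul_pow ‖z C‖, sq (2 * B.radius ^ 2)]
      exact mul_le_mul (hlow C hC) (hlow D hD) (by positivity) (by positivity)
    linarith

/-- An orthogonal arrangement has a circle meeting at most eight others. -/
lemma exists_card_intersects_le (𝒜 : Finset Circ) (hne : 𝒜.Nonempty)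
    (ho : (𝒜 : Set Circ).Pairwise fun X Y => Intersects X Y → Orthogonal X Y) :
    ∃ B ∈ 𝒜, (𝒜.filter fun C => C ≠ B ∧ Intersects C B).card ≤ 8 := by
  have hsub : ∀ (p : Circ → Prop) [DecidablePred p], ((𝒜.filter p : Finset Circ) : Set Circ) ⊆ 𝒜 := fun p _ =>
    Finset.coe_subset.2 (Finset.filter_subset p 𝒜)
  by_cases hnest : ∃ A ∈ 𝒜, ∃ B ∈ 𝒜, B.Inside A
  · obtain ⟨A, hA, hAmin⟩ := (𝒜.filter fun A => ∃ B ∈ 𝒜, B.Inside A).exists_min_image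
      Circ.radius (by obtain ⟨A, hA⟩ := hnest; exact ⟨A, Finset.mem_filter.2 hA⟩)
    obtain ⟨hA, B₀, hB₀, hB₀A⟩ := Finset.mem_filter.1 hA
    obtain ⟨B, hB, hBmin⟩ := (𝒜.filter fun B => B.Inside A).exists_min_image
      Circ.radius ⟨B₀, Finset.mem_filter.2 ⟨hB₀, hB₀A⟩⟩
    obtain ⟨hB, hBA⟩ := Finset.mem_filter.1 hB
    refine ⟨B, hB, ?_⟩
    set N := 𝒜.filter fun C => C ≠ B ∧ Intersects C B with hN
    have hNo : ∀ C ∈ N, C ∈ 𝒜 ∧ Orthogonal C B := by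
      intro C hC
      obtain ⟨h₁, h₂, h₃⟩ := Finset.mem_filter.1 hC
      exact ⟨h₁, ho h₁ hB h₂ h₃⟩
    have hN𝒜 : ∀ (p : Circ → Prop) [DecidablePred p], ((N.filter p : Finset Circ) : Set Circ) ⊆ 𝒜 := fun p _ =>
      (Finset.coe_subset.2 (Finset.filter_subset p N)).trans (hsub _)
    have h₁ : (N.filter fun C => Orthogonal C A).card ≤ 2 := by
      refine hBA.card_common_orthogonal_le _ (ho.mono (hN𝒜 _)) ?_ ?_
      · exact fun C hC => (Finset.mem_filter.1 hC).2
      · exact fun C hC => (hNo C (Finset.mem_filter.1 hC).1).2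
    have hin : ∀ C ∈ N.filter fun C => ¬ Orthogonal C A, C.Inside A := by
      intro C hC
      obtain ⟨hCN, hCA⟩ := Finset.mem_filter.1 hC
      obtain ⟨hC, hCB⟩ := hNo C hCN
      have hne : C ≠ A := by
        rintro rfl
        exact hCB.symm.not_inside hBA
      rcases intersects_or_separated C A with h | h | h | h
      · exact absurd (ho hC hA hne h) hCA
      · have := hCB.dist_lt
        have := dist_triangle C.center B.center A.center
        unfold Inside at hBA
        linarith
      · exact h
      · exact absurd (hBA.trans h) hCB.symm.not_inside
    have h₂ : (N.filter fun C => ¬ Orthogonal C A).card ≤ 6 := by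
      refine card_le_six_of_not_inside B _ (ho.mono (hN𝒜 _)) ?_ ?_ ?_
      · exact fun C hC => (hNo C (Finset.mem_filter.1 hC).1).2
      · exact fun C hC => hBmin C (Finset.mem_filter.2 ⟨hN𝒜 _ hC, hin C hC⟩)
      · intro C hC D hD hCD
        have := hAmin D (Finset.mem_filter.2 ⟨hN𝒜 _ hD, C, hN𝒜 _ hC, hCD⟩)
        exact absurd (hin D hD).radius_lt this.not_gt
    have := Finset.card_filter_add_card_filter_not (s := N) (fun C => Orthogonal C A)
    omega
  · push Not at hnest
    obtain ⟨B, hB, hBmin⟩ := 𝒜.exists_min_image Circ.radius hne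
    refine ⟨B, hB, le_trans (card_le_six_of_not_inside B _ (ho.mono (hsub _)) ?_ ?_ ?_)
      (by norm_num)⟩
    · intro C hC
      obtain ⟨h₁, h₂, h₃⟩ := Finset.mem_filter.1 hC
      exact ho h₁ hB h₂ h₃
    · exact fun C hC => hBmin C (hsub _ hC)
    · exact fun C hC D hD => hnest D (hsub _ hD) C (hsub _ hC)

end Circ

lemma incCount_singleton_le (𝒜 : Finset Circ) (B : Circ) :
    incCount 𝒜 {B} ≤ (𝒜.filter fun C => C ≠ B ∧ Intersects C B).card := by
  unfold incCount
  refine le_trans (Finset.card_le_card ?_) (Finset.card_image_le (f := fun C => {C, B}))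
  intro e he
  simp only [Finset.mem_filter, Finset.mem_powersetCard, Finset.mem_singleton] at he
  obtain ⟨⟨hsub, hcard⟩, ⟨X, hX, Y, hY, hXY, hint⟩, Z, hZ, rfl⟩ := he
  have he : e = {X, Y} := by
    symm
    apply Finset.eq_of_subset_of_card_le
    · intro W hW
      rcases Finset.mem_insert.1 hW with rfl | hW
      · exact hX
      · rwa [Finset.mem_singleton.1 hW]
    · rw [hcard, Finset.card_pair hXY]
  rw [he, Finset.mem_insert, Finset.mem_singleton] at hZ
  rw [Finset.mem_image]
  rcases hZ with rfl | rfl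
  · exact ⟨Y, Finset.mem_filter.2 ⟨hsub hY, hXY.symm, intersects_comm.1 hint⟩,
      by rw [he, Finset.pair_comm]⟩
  · exact ⟨X, Finset.mem_filter.2 ⟨hsub hX, hXY, hint⟩, he.symm⟩

theorem stmt10 (𝒜 : Finset Circ) (hne : 𝒜.Nonempty)
    (ho : (𝒜 : Set Circ).Pairwise fun X Y => Intersects X Y → Orthogonal X Y) :
    ∃ S ⊆ 𝒜, S.Nonempty ∧ incCount 𝒜 S ≤ 4 * S.card + 5 := by
  obtain ⟨B, hB, hcard⟩ := exists_card_intersects_le 𝒜 hne ho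
  refine ⟨{B}, Finset.singleton_subset_iff.2 hB, Finset.singleton_nonempty B, ?_⟩
  have := incCount_singleton_le 𝒜 B
  rw [Finset.card_singleton]
  omega
end
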